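/- If u is a C⁴ function on Ω_r satisfying □ₘ u = 0, then Su also satisfies □ₘ(Su) = 0; that is, S maps C⁴ solutions of the reduced wave equation to C² solutions. -/

import Mathlib

noncomputable section

/-- Functions of `(t, r, θ)`. -/
abbrev F3 := ℝ × ℝ × ℝ → ℂ

/-- Partial derivative with respect to `t`. -/
noncomputable def dT (u : F3) (p : ℝ × ℝ × ℝ) : ℂ :=
  deriv (fun s => u (s, p.2.1, p.2.2)) p.1

/-- Partial derivative with respect to `r`. -/
noncomputable def dR (u : F3) (p : ℝ × ℝ × ℝ) : ℂ :=
  deriv (fun s => u (p.1, s, p.2.2)) p.2.1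

/-- Partial derivative with respect to `θ`. -/
noncomputable def dTh (u : F3) (p : ℝ × ℝ × ℝ) : ℂ :=
  deriv (fun s => u (p.1, p.2.1, s)) p.2.2

/-- `Δ = r² - 2Mr + a²`. -/
def Del (M a r : ℝ) : ℝ := r ^ 2 - 2 * M * r + a ^ 2

/-- `Σ = r² + a² cos² θ`. -/
def Sig (a r θ : ℝ) : ℝ := r ^ 2 + a ^ 2 * Real.cos θ ^ 2

/-- `r₊ = M + √(M² - a²)`. -/
noncomputable def rplus (M a : ℝ) : ℝ := M + Real.sqrt (M ^ 2 - a ^ 2)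

/-- `Ω_r = ℝ × (r₊, ∞) × (0, π)`. -/
def OmegaR (M a : ℝ) : Set (ℝ × ℝ × ℝ) :=
  {p | rplus M a < p.2.1 ∧ 0 < p.2.2 ∧ p.2.2 < Real.pi}

/-- The reduced Kerr wave operator `□ₘ`. -/
noncomputable def boxm (M a : ℝ) (m : ℤ) (u : F3) : F3 := fun p =>
  (Complex.ofReal (Sig a p.2.1 p.2.2))⁻¹ *
    (Complex.ofReal ((p.2.1 ^ 2 + a ^ 2) ^ 2 / Del M a p.2.1
        - a ^ 2 * Real.sin p.2.2 ^ 2) * dT (dT u) p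
      + 4 * Complex.I * (m : ℂ) * Complex.ofReal M * Complex.ofReal a
          * Complex.ofReal p.2.1 / Complex.ofReal (Del M a p.2.1) * dT u p
      - dR (fun q => Complex.ofReal (Del M a q.2.1) * dR u q) p
      - (Complex.ofReal (Real.sin p.2.2))⁻¹
          * dTh (fun q => Complex.ofReal (Real.sin q.2.2) * dTh u q) p
      - (m : ℂ) ^ 2 * Complex.ofReal (a ^ 2 / Del M a p.2.1
          - (Real.sin p.2.2 ^ 2)⁻¹) * u p)

/-- The Killing-tensor operator `□̄ₘ`. -/
noncomputable def barboxm (M a : ℝ) (m : ℤ) (u : F3) : F3 := fun p =>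
  (Complex.ofReal (Sig a p.2.1 p.2.2))⁻¹ *
    (Complex.ofReal (a ^ 2 * (p.2.1 ^ 2 * Real.sin p.2.2 ^ 2
        + Real.cos p.2.2 ^ 2 * (p.2.1 ^ 2 + a ^ 2) ^ 2 / Del M a p.2.1)) * dT (dT u) p
      + 2 * Complex.I * (m : ℂ) * Complex.ofReal a
          * Complex.ofReal (p.2.1 ^ 2 + a ^ 2 * Real.cos p.2.2 ^ 2
              * (p.2.1 ^ 2 + a ^ 2) / Del M a p.2.1) * dT u p
      - Complex.ofReal (a ^ 2 * Real.cos p.2.2 ^ 2)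
          * dR (fun q => Complex.ofReal (Del M a q.2.1) * dR u q) p
      + Complex.ofReal (p.2.1 ^ 2 / Real.sin p.2.2)
          * dTh (fun q => Complex.ofReal (Real.sin q.2.2) * dTh u q) p
      - (m : ℂ) ^ 2 * Complex.ofReal (p.2.1 ^ 2 / Real.sin p.2.2 ^ 2
          + a ^ 4 * Real.cos p.2.2 ^ 2 / Del M a p.2.1) * u p)

/-- The ladder operator `Dₙ`. -/
noncomputable def Dlad (M a : ℝ) (m n : ℤ) (u : F3) : F3 := fun p =>
  dR u p + (Complex.ofReal (Del M a p.2.1))⁻¹ *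
      (Complex.ofReal (p.2.1 ^ 2 + a ^ 2) * dT u p
        + Complex.I * (m : ℂ) * Complex.ofReal a * u p)
    + Complex.ofReal (2 * (n : ℝ) * (p.2.1 - M) / Del M a p.2.1) * u p

/-- The ladder operator `Dₙ⁺`. -/
noncomputable def DladP (M a : ℝ) (m n : ℤ) (u : F3) : F3 := fun p =>
  dR u p - (Complex.ofReal (Del M a p.2.1))⁻¹ *
      (Complex.ofReal (p.2.1 ^ 2 + a ^ 2) * dT u p
        + Complex.I * (m : ℂ) * Complex.ofReal a * u p)
    + Complex.ofReal (2 * (n : ℝ) * (p.2.1 - M) / Del M a p.2.1) * u p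

/-- The ladder operator `Lₙ`. -/
noncomputable def Llad (a : ℝ) (m n : ℤ) (u : F3) : F3 := fun p =>
  dTh u p + (-Complex.I * Complex.ofReal a * Complex.ofReal (Real.sin p.2.2) * dT u p
      + (m : ℂ) * (Complex.ofReal (Real.sin p.2.2))⁻¹ * u p)
    + (n : ℂ) * Complex.ofReal (Real.cos p.2.2 / Real.sin p.2.2) * u p

/-- The ladder operator `Lₙ⁺`. -/
noncomputable def LladP (a : ℝ) (m n : ℤ) (u : F3) : F3 := fun p =>
  dTh u p - (-Complex.I * Complex.ofReal a * Complex.ofReal (Real.sin p.2.2) * dT u p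
      + (m : ℂ) * (Complex.ofReal (Real.sin p.2.2))⁻¹ * u p)
    + (n : ℂ) * Complex.ofReal (Real.cos p.2.2 / Real.sin p.2.2) * u p

/-- `D² = D₁D₀⁺ + D₁⁺D₀`. -/
noncomputable def D2 (M a : ℝ) (m : ℤ) (u : F3) : F3 := fun p =>
  Dlad M a m 1 (DladP M a m 0 u) p + DladP M a m 1 (Dlad M a m 0 u) p

/-- `L² = L₁L₀⁺ + L₁⁺L₀`. -/
noncomputable def L2 (a : ℝ) (m : ℤ) (u : F3) : F3 := fun p =>
  Llad a m 1 (LladP a m 0 u) p + LladP a m 1 (Llad a m 0 u) p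

/-- The operator `P` appearing in the symmetry operator `S`. -/
noncomputable def Pop (M a : ℝ) (m : ℤ) (u : F3) : F3 := fun p =>
  -2 * Complex.I * (m : ℂ) * Complex.ofReal a
      * Complex.ofReal ((p.2.1 ^ 2 + a ^ 2) * Sig a p.2.1 p.2.2) * dT u p
    - Complex.ofReal (a ^ 2 * Real.sin p.2.2 ^ 2 * Del M a p.2.1)
        * dR (fun q => Complex.ofReal (Del M a q.2.1) * dR u q) p
    - Complex.ofReal ((p.2.1 ^ 2 + a ^ 2) ^ 2 / Real.sin p.2.2)
        * dTh (fun q => Complex.ofReal (Real.sin q.2.2) * dTh u q) p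
    + (m : ℂ) ^ 2 * Complex.ofReal (Sig a p.2.1 p.2.2 / Real.sin p.2.2 ^ 2
        * (Sig a p.2.1 p.2.2 + 2 * a ^ 2 * Real.sin p.2.2 ^ 2)) * u p

/-- The new first-order-in-time symmetry operator `S`. -/
noncomputable def Sop (M a : ℝ) (m : ℤ) (u : F3) : F3 := fun p =>
  (Complex.ofReal ((p.2.1 ^ 2 + a ^ 2) * Sig a p.2.1 p.2.2
      + 2 * M * a ^ 2 * p.2.1 * Real.sin p.2.2 ^ 2))⁻¹ * Pop M a m u p

end

section DirectionalDerivatives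

variable {E : Type*} [NormedAddCommGroup E] [NormedSpace ℝ E]

/-- The derivative of `f` in the fixed direction `e`, as a function. -/
noncomputable def pd (e : E) (f : E → ℂ) : E → ℂ := fun p => lineDeriv ℝ f p e

/-- `c` is constant along every line with direction `e`. -/
def InvariantAlong (e : E) (c : E → ℂ) : Prop := ∀ (p : E) (t : ℝ), c (p + t • e) = c p

variable {U : Set E} {e e' : E} {f g c : E → ℂ} {p : E}

lemma pd_congr (hU : IsOpen U) (h : Set.EqOn f g U) : Set.EqOn (pd e f) (pd e g) U :=
  fun _ hp => Filter.EventuallyEq.lineDeriv_eq (h.eventuallyEq_of_mem (hU.mem_nhds hp))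

lemma pd_mul_of_invariant (hc : InvariantAlong e c) (f : E → ℂ) :
    pd e (c * f) = c * pd e f := by
  ext p
  simp only [pd, lineDeriv, Pi.mul_apply, hc p]
  exact deriv_const_mul_field _

lemma pd_eqOn_fderiv (hU : IsOpen U) (hf : DifferentiableOn ℝ f U) :
    Set.EqOn (pd e f) (fun q => fderiv ℝ f q e) U :=
  fun _ hp => (hf.differentiableAt (hU.mem_nhds hp)).lineDeriv_eq_fderiv

lemma pd_add (hU : IsOpen U) (hf : DifferentiableOn ℝ f U) (hg : DifferentiableOn ℝ g U) :
    Set.EqOn (pd e (f + g)) (pd e f + pd e g) U := by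
  intro p hp
  rw [pd_eqOn_fderiv hU (hf.add hg) hp, Pi.add_apply, pd_eqOn_fderiv hU hf hp,
    pd_eqOn_fderiv hU hg hp]
  simp only
  rw [fderiv_add (hf.differentiableAt (hU.mem_nhds hp)) (hg.differentiableAt (hU.mem_nhds hp))]
  rfl

lemma ContDiffOn.pd {n k : WithTop ℕ∞} (hU : IsOpen U) (hf : ContDiffOn ℝ n f U)
    (hk : k + 1 ≤ n) (e : E) : ContDiffOn ℝ k (pd e f) U := by
  refine ((hf.fderiv_of_isOpen hU hk).clm_apply (contDiffOn_const (c := e))).congr ?_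
  refine pd_eqOn_fderiv hU (hf.differentiableOn ?_)
  rintro rfl
  simp at hk

lemma pd_comm (hU : IsOpen U) (hf : ContDiffOn ℝ 2 f U) :
    Set.EqOn (pd e (pd e' f)) (pd e' (pd e f)) U := by
  have hd : DifferentiableOn ℝ f U := hf.differentiableOn (by norm_num)
  have hdd : DifferentiableOn ℝ (fderiv ℝ f) U :=
    (hf.fderiv_of_isOpen hU (m := 1) (by norm_num)).differentiableOn (by norm_num)
  have key : ∀ v w : E, Set.EqOn (pd v (pd w f)) (fun p => fderiv ℝ (fderiv ℝ f) p v w) U := by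
    intro v w p hp
    have h1 : DifferentiableAt ℝ (fderiv ℝ f) p := hdd.differentiableAt (hU.mem_nhds hp)
    rw [pd_congr hU (pd_eqOn_fderiv hU hd) hp,
      pd_eqOn_fderiv hU (hdd.clm_apply (differentiableOn_const w)) hp]
    simp only
    rw [fderiv_clm_apply h1 (differentiableAt_const w)]
    simp
  intro p hp
  rw [key e e' hp, key e' e hp]
  exact ((hf.contDiffAt (hU.mem_nhds hp)).isSymmSndFDerivAt (by simp)) e e'

/-- The second-order operator `α ∂ₓ² + β ∂ₓ + η ∂_y (δ ∂_y) + γ`. -/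
noncomputable def secondOrderOp (x y : E) (α β η δ γ : E → ℂ) (v : E → ℂ) : E → ℂ :=
  α * pd x (pd x v) + β * pd x v + η * pd y (δ * pd y v) + γ * v

variable {x y z : E} {α β η δ γ v w α' β' η' δ' γ' : E → ℂ}

lemma secondOrderOp_congr (hU : IsOpen U) (h : Set.EqOn v w U) :
    Set.EqOn (secondOrderOp x y α β η δ γ v) (secondOrderOp x y α β η δ γ w) U := by
  intro p hp
  have hy : Set.EqOn (δ * pd y v) (δ * pd y w) U := fun q hq => by
    simp [pd_congr hU h hq]
  simp [secondOrderOp, pd_congr hU (pd_congr hU h) hp, pd_congr hU h hp, pd_congr hU hy hp, h hp]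

lemma secondOrderOp_mul (hx : InvariantAlong x c) (hy : InvariantAlong y c) (v : E → ℂ) :
    secondOrderOp x y α β η δ γ (c * v) = c * secondOrderOp x y α β η δ γ v := by
  simp only [secondOrderOp, pd_mul_of_invariant hx, pd_mul_of_invariant hy, mul_left_comm δ c]
  ring

lemma secondOrderOp_add (hU : IsOpen U) (hδ : ContDiffOn ℝ 1 δ U)
    (hv : ContDiffOn ℝ 2 v U) (hw : ContDiffOn ℝ 2 w U) :
    Set.EqOn (secondOrderOp x y α β η δ γ (v + w))
      (secondOrderOp x y α β η δ γ v + secondOrderOp x y α β η δ γ w) U := by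
  have hd {f : E → ℂ} (hf : ContDiffOn ℝ 2 f U) : DifferentiableOn ℝ f U :=
    hf.differentiableOn (by norm_num)
  have hd' {f : E → ℂ} (hf : ContDiffOn ℝ 2 f U) (e : E) : ContDiffOn ℝ 1 (pd e f) U :=
    hf.pd hU (by norm_num) e
  have h1 (e : E) := pd_add (e := e) hU (hd hv) (hd hw)
  have h2 : Set.EqOn (pd x (pd x (v + w))) (pd x (pd x v) + pd x (pd x w)) U :=
    (pd_congr hU (h1 x)).trans (pd_add hU ((hd' hv x).differentiableOn (by norm_num))
      ((hd' hw x).differentiableOn (by norm_num)))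
  have h3 : Set.EqOn (δ * pd y (v + w)) (δ * pd y v + δ * pd y w) U := fun q hq => by
    simp [h1 y hq, mul_add]
  have h4 : Set.EqOn (pd y (δ * pd y (v + w))) (pd y (δ * pd y v) + pd y (δ * pd y w)) U :=
    (pd_congr hU h3).trans (pd_add hU ((hδ.mul (hd' hv y)).differentiableOn (by norm_num))
      ((hδ.mul (hd' hw y)).differentiableOn (by norm_num)))
  intro p hp
  simp only [secondOrderOp, Pi.add_apply, Pi.mul_apply, h2 hp, h4 hp, h1 x hp]
  ring

lemma ContDiffOn.secondOrderOp {n k : WithTop ℕ∞} (hU : IsOpen U) (hα : ContDiffOn ℝ k α U)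
    (hβ : ContDiffOn ℝ k β U) (hη : ContDiffOn ℝ k η U) (hδ : ContDiffOn ℝ (k + 1) δ U)
    (hγ : ContDiffOn ℝ k γ U) (hv : ContDiffOn ℝ n v U) (hk : k + 1 + 1 ≤ n) :
    ContDiffOn ℝ k (secondOrderOp x y α β η δ γ v) U := by
  have h1 (e : E) : ContDiffOn ℝ (k + 1) (_root_.pd e v) U := hv.pd hU hk e
  have hle : k ≤ k + 1 := le_self_add
  exact (((hα.mul ((h1 x).pd hU le_rfl x)).add (hβ.mul ((h1 x).of_le hle))).add
    (hη.mul ((hδ.mul (h1 y)).pd hU le_rfl y))).add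
      (hγ.mul (hv.of_le (hle.trans (le_self_add.trans hk))))

/-- A directional derivative along which all coefficients are invariant commutes with the
operator. -/
lemma pd_secondOrderOp (hU : IsOpen U) (hα : ContDiffOn ℝ 1 α U)
    (hβ : ContDiffOn ℝ 1 β U) (hη : ContDiffOn ℝ 1 η U) (hδ : ContDiffOn ℝ 2 δ U)
    (hγ : ContDiffOn ℝ 1 γ U) (hv : ContDiffOn ℝ 3 v U)
    (iα : InvariantAlong e α) (iβ : InvariantAlong e β) (iη : InvariantAlong e η)
    (iδ : InvariantAlong e δ) (iγ : InvariantAlong e γ) :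
    Set.EqOn (pd e (secondOrderOp x y α β η δ γ v))
      (secondOrderOp x y α β η δ γ (pd e v)) U := by
  have h2 (e : E) : ContDiffOn ℝ 2 (pd e v) U := hv.pd hU (by norm_num) e
  have hv2 : ContDiffOn ℝ 2 v U := hv.of_le (by norm_num)
  have hx : Set.EqOn (pd e (pd x v)) (pd x (pd e v)) U := pd_comm hU hv2
  have hxx : Set.EqOn (pd e (pd x (pd x v))) (pd x (pd x (pd e v))) U :=
    (pd_comm hU (h2 x)).trans (pd_congr hU hx)
  have hy : Set.EqOn (pd e (δ * pd y v)) (δ * pd y (pd e v)) U := fun q hq => by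
    rw [pd_mul_of_invariant iδ, Pi.mul_apply, pd_comm hU hv2 hq, Pi.mul_apply]
  have hyy : Set.EqOn (pd e (pd y (δ * pd y v))) (pd y (δ * pd y (pd e v))) U :=
    (pd_comm hU (hδ.mul (h2 y))).trans (pd_congr hU hy)
  have d1 : DifferentiableOn ℝ (α * pd x (pd x v)) U :=
    (hα.mul ((h2 x).pd hU (by norm_num) x)).differentiableOn (by norm_num)
  have d2 : DifferentiableOn ℝ (β * pd x v) U :=
    (hβ.mul ((h2 x).of_le (by norm_num))).differentiableOn (by norm_num)
  have d3 : DifferentiableOn ℝ (η * pd y (δ * pd y v)) U :=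
    (hη.mul ((hδ.mul (h2 y)).pd hU (by norm_num) y)).differentiableOn (by norm_num)
  have d4 : DifferentiableOn ℝ (γ * v) U :=
    (hγ.mul (hv.of_le (by norm_num))).differentiableOn (by norm_num)
  intro p hp
  rw [secondOrderOp, pd_add hU ((d1.add d2).add d3) d4 hp, Pi.add_apply,
    pd_add hU (d1.add d2) d3 hp, Pi.add_apply, pd_add hU d1 d2 hp, Pi.add_apply,
    pd_mul_of_invariant iα, pd_mul_of_invariant iβ, pd_mul_of_invariant iη,
    pd_mul_of_invariant iγ]
  simp [secondOrderOp, hx hp, hxx hp, hyy hp]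

/-- Two second-order operators in separated variables commute on `C⁴` functions. -/
lemma secondOrderOp_comm (hU : IsOpen U) (hα : ContDiffOn ℝ 4 α U)
    (hβ : ContDiffOn ℝ 4 β U) (hη : ContDiffOn ℝ 4 η U) (hδ : ContDiffOn ℝ 4 δ U)
    (hγ : ContDiffOn ℝ 4 γ U) (hα' : ContDiffOn ℝ 4 α' U)
    (hβ' : ContDiffOn ℝ 4 β' U) (hη' : ContDiffOn ℝ 4 η' U) (hδ' : ContDiffOn ℝ 4 δ' U)
    (hγ' : ContDiffOn ℝ 4 γ' U) (hv : ContDiffOn ℝ 4 v U)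
    (i : ∀ e ∈ ({x, z} : Set E), ∀ c ∈ ({α, β, η, δ, γ} : Set (E → ℂ)), InvariantAlong e c)
    (i' : ∀ e ∈ ({x, y} : Set E), ∀ c ∈ ({α', β', η', δ', γ'} : Set (E → ℂ)),
      InvariantAlong e c) :
    Set.EqOn (secondOrderOp x y α β η δ γ (secondOrderOp x z α' β' η' δ' γ' v))
      (secondOrderOp x z α' β' η' δ' γ' (secondOrderOp x y α β η δ γ v)) U := by
  set A := secondOrderOp x y α β η δ γ with hA
  have lower {f : E → ℂ} (hf : ContDiffOn ℝ 4 f U) {k : WithTop ℕ∞} (hk : k ≤ 4) :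
    ContDiffOn ℝ k f U := hf.of_le hk
  have h3 (e : E) : ContDiffOn ℝ 3 (pd e v) U := hv.pd hU (by norm_num) e
  have comm {e : E} (he : e ∈ ({x, z} : Set E)) {f : E → ℂ} (hf : ContDiffOn ℝ 3 f U) :
      Set.EqOn (pd e (A f)) (A (pd e f)) U :=
    pd_secondOrderOp hU (lower hα (by norm_num)) (lower hβ (by norm_num))
      (lower hη (by norm_num)) (lower hδ (by norm_num)) (lower hγ (by norm_num)) hf
      (i e he _ (by simp)) (i e he _ (by simp)) (i e he _ (by simp)) (i e he _ (by simp))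
      (i e he _ (by simp))
  have hmul {c : E → ℂ} (hc : c ∈ ({α', β', η', δ', γ'} : Set (E → ℂ))) (f : E → ℂ) :
      A (c * f) = c * A f :=
    secondOrderOp_mul (i' x (by simp) c hc) (i' y (by simp) c hc) f
  have hx : Set.EqOn (A (pd x v)) (pd x (A v)) U := (comm (by simp) (lower hv (by norm_num))).symm
  have hxx : Set.EqOn (A (pd x (pd x v))) (pd x (pd x (A v))) U :=
    (comm (by simp) (h3 x)).symm.trans (pd_congr hU hx)
  have hz : Set.EqOn (A (δ' * pd z v)) (δ' * pd z (A v)) U := fun q hq => by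
    rw [hmul (by simp), Pi.mul_apply, Pi.mul_apply, comm (by simp) (lower hv (by norm_num)) hq]
  have hδz : ContDiffOn ℝ 3 (δ' * pd z v) U := (lower hδ' (by norm_num)).mul (h3 z)
  have hzz : Set.EqOn (A (pd z (δ' * pd z v))) (pd z (δ' * pd z (A v))) U :=
    (comm (by simp) hδz).symm.trans (pd_congr hU hz)
  have c1 : ContDiffOn ℝ 2 (α' * pd x (pd x v)) U :=
    (lower hα' (by norm_num)).mul ((h3 x).pd hU (by norm_num) x)
  have c2 : ContDiffOn ℝ 2 (β' * pd x v) U :=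
    (lower hβ' (by norm_num)).mul ((h3 x).of_le (by norm_num))
  have c3 : ContDiffOn ℝ 2 (η' * pd z (δ' * pd z v)) U :=
    (lower hη' (by norm_num)).mul (hδz.pd hU (by norm_num) z)
  have c4 : ContDiffOn ℝ 2 (γ' * v) U :=
    (lower hγ' (by norm_num)).mul (lower hv (by norm_num))
  have c12 : ContDiffOn ℝ 2 (α' * pd x (pd x v) + β' * pd x v) U := c1.add c2
  have c123 : ContDiffOn ℝ 2
      (α' * pd x (pd x v) + β' * pd x v + η' * pd z (δ' * pd z v)) U := c12.add c3
  have hδ1 : ContDiffOn ℝ 1 δ U := lower hδ (by norm_num)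
  intro p hp
  have e1 := secondOrderOp_add (x := x) (y := y) (α := α) (β := β) (η := η) (γ := γ) hU hδ1
    c123 c4 hp
  have e2 := secondOrderOp_add (x := x) (y := y) (α := α) (β := β) (η := η) (γ := γ) hU hδ1
    c12 c3 hp
  have e3 := secondOrderOp_add (x := x) (y := y) (α := α) (β := β) (η := η) (γ := γ) hU hδ1
    c1 c2 hp
  rw [← hA] at e1 e2 e3
  rw [Pi.add_apply] at e1 e2 e3
  conv_lhs => rw [secondOrderOp]
  rw [e1, e2, e3, hmul (by simp), hmul (by simp), hmul (by simp), hmul (by simp)]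
  simp [secondOrderOp, hx hp, hxx hp, hzz hp]

end DirectionalDerivatives

section Kerr

lemma dT_eq_pd (u : F3) : dT u = pd (1, 0, 0) u := by
  ext p
  have := deriv_comp_const_add (fun s => u (s, p.2.1, p.2.2)) p.1 0
  simp only [add_zero] at this
  simp only [dT, pd, lineDeriv, ← this]
  congr 1
  ext t
  congr 1
  ext <;> simp

lemma dR_eq_pd (u : F3) : dR u = pd (0, 1, 0) u := by
  ext p
  have := deriv_comp_const_add (fun s => u (p.1, s, p.2.2)) p.2.1 0
  simp only [add_zero] at this
  simp only [dR, pd, lineDeriv, ← this]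
  congr 1
  ext t
  congr 1
  ext <;> simp

lemma dTh_eq_pd (u : F3) : dTh u = pd (0, 0, 1) u := by
  ext p
  have := deriv_comp_const_add (fun s => u (p.1, p.2.1, s)) p.2.2 0
  simp only [add_zero] at this
  simp only [dTh, pd, lineDeriv, ← this]
  congr 1
  ext t
  congr 1
  ext <;> simp

lemma isOpen_OmegaR (M a : ℝ) : IsOpen (OmegaR M a) := by
  have h1 : IsOpen {p : ℝ × ℝ × ℝ | rplus M a < p.2.1} := isOpen_lt (by fun_prop) (by fun_prop)
  have h2 : IsOpen {p : ℝ × ℝ × ℝ | 0 < p.2.2} := isOpen_lt (by fun_prop) (by fun_prop)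
  have h3 : IsOpen {p : ℝ × ℝ × ℝ | p.2.2 < Real.pi} := isOpen_lt (by fun_prop) (by fun_prop)
  exact h1.inter (h2.inter h3)

lemma Del_pos {M a r : ℝ} (ha : 0 ≤ a) (haM : a ≤ M) (hr : rplus M a < r) : 0 < Del M a r := by
  have h0 : 0 ≤ M ^ 2 - a ^ 2 := by nlinarith
  have h1 := Real.sq_sqrt h0
  have h2 := Real.sqrt_nonneg (M ^ 2 - a ^ 2)
  unfold rplus at hr
  unfold Del
  nlinarith

/-- The radial part of `Σ □ₘ`. -/
noncomputable def radialOp (M a : ℝ) (m : ℤ) : F3 → F3 :=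
  secondOrderOp (1, 0, 0) (0, 1, 0)
    (fun p => Complex.ofReal ((p.2.1 ^ 2 + a ^ 2) ^ 2 / Del M a p.2.1))
    (fun p => 4 * Complex.I * (m : ℂ) * Complex.ofReal (M * a * p.2.1 / Del M a p.2.1))
    (fun _ => -1)
    (fun p => Complex.ofReal (Del M a p.2.1))
    (fun p => -(m : ℂ) ^ 2 * Complex.ofReal (a ^ 2 / Del M a p.2.1))

/-- The angular part of `Σ □ₘ`. -/
noncomputable def angularOp (a : ℝ) (m : ℤ) : F3 → F3 :=
  secondOrderOp (1, 0, 0) (0, 0, 1)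
    (fun p => Complex.ofReal (-(a ^ 2 * Real.sin p.2.2 ^ 2)))
    (fun _ => 0)
    (fun p => Complex.ofReal (-(Real.sin p.2.2)⁻¹))
    (fun p => Complex.ofReal (Real.sin p.2.2))
    (fun p => (m : ℂ) ^ 2 * Complex.ofReal ((Real.sin p.2.2 ^ 2)⁻¹))

lemma boxm_eq (M a : ℝ) (m : ℤ) (u : F3) (p : ℝ × ℝ × ℝ) :
    boxm M a m u p = (Complex.ofReal (Sig a p.2.1 p.2.2))⁻¹ *
      (radialOp M a m u p + angularOp a m u p) := by
  simp only [boxm, radialOp, angularOp, secondOrderOp, dT_eq_pd, dR_eq_pd, dTh_eq_pd,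
    Pi.add_apply, Pi.mul_apply]
  have h1 : ((fun p : ℝ × ℝ × ℝ => Complex.ofReal (Del M a p.2.1)) * pd (0, 1, 0) u) =
    fun q => Complex.ofReal (Del M a q.2.1) * pd (0, 1, 0) u q := rfl
  have h2 : ((fun p : ℝ × ℝ × ℝ => Complex.ofReal (Real.sin p.2.2)) * pd (0, 0, 1) u) =
    fun q => Complex.ofReal (Real.sin q.2.2) * pd (0, 0, 1) u q := rfl
  rw [h1, h2]
  push_cast
  ring

lemma Sig_pos_of_mem {M a : ℝ} (hM : 0 < M) {p : ℝ × ℝ × ℝ} (hp : p ∈ OmegaR M a) :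
    0 < Sig a p.2.1 p.2.2 := by
  have h1 : rplus M a < p.2.1 := hp.1
  have h2 := Real.sqrt_nonneg (M ^ 2 - a ^ 2)
  have h3 : 0 < p.2.1 := by unfold rplus at h1; linarith
  unfold Sig
  positivity

/-- On solutions, `S` agrees with `-A - 2ima ∂ₜ`, where `A` is the radial part of `Σ □ₘ`. -/
lemma Sop_eq {M a : ℝ} (hM : 0 < M) (ha : 0 ≤ a) (haM : a ≤ M) (m : ℤ) {u : F3}
    {p : ℝ × ℝ × ℝ} (hp : p ∈ OmegaR M a) (h : radialOp M a m u p + angularOp a m u p = 0) :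
    Sop M a m u p = -radialOp M a m u p
      + (-2 * Complex.I * (m : ℂ) * Complex.ofReal a) * pd (1, 0, 0) u p := by
  have hΔ := Del_pos ha haM hp.1
  have hs : 0 < Real.sin p.2.2 := Real.sin_pos_of_pos_of_lt_pi hp.2.1 hp.2.2
  have hSig_pos := Sig_pos_of_mem hM hp
  have hr : 0 < p.2.1 := by
    have h1 : rplus M a < p.2.1 := hp.1
    have h2 := Real.sqrt_nonneg (M ^ 2 - a ^ 2)
    unfold rplus at h1
    linarith
  have hN : 0 < (p.2.1 ^ 2 + a ^ 2) * Sig a p.2.1 p.2.2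
      + 2 * M * a ^ 2 * p.2.1 * Real.sin p.2.2 ^ 2 := by positivity
  have hN' : Complex.ofReal ((p.2.1 ^ 2 + a ^ 2) * Sig a p.2.1 p.2.2
      + 2 * M * a ^ 2 * p.2.1 * Real.sin p.2.2 ^ 2) ≠ 0 := by exact_mod_cast hN.ne'
  rw [Sop, inv_mul_eq_iff_eq_mul₀ hN']
  have hSig : Sig a p.2.1 p.2.2 = p.2.1 ^ 2 + a ^ 2 - a ^ 2 * Real.sin p.2.2 ^ 2 := by
    rw [Sig, Real.cos_sq']; ring
  have hM2 : 2 * M * p.2.1 = p.2.1 ^ 2 + a ^ 2 - Del M a p.2.1 := by rw [Del]; ring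
  suffices hkey : Pop M a m u p - Complex.ofReal ((p.2.1 ^ 2 + a ^ 2) * Sig a p.2.1 p.2.2
      + 2 * M * a ^ 2 * p.2.1 * Real.sin p.2.2 ^ 2) * (-radialOp M a m u p
      + (-2 * Complex.I * (m : ℂ) * Complex.ofReal a) * pd (1, 0, 0) u p)
      = Complex.ofReal ((p.2.1 ^ 2 + a ^ 2) ^ 2)
        * (radialOp M a m u p + angularOp a m u p) by
    rw [h, mul_zero] at hkey
    exact sub_eq_zero.mp hkey
  simp only [Pop, radialOp, angularOp, secondOrderOp, dT_eq_pd, dR_eq_pd, dTh_eq_pd,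
    Pi.add_apply, Pi.mul_apply]
  have h1 : ((fun p : ℝ × ℝ × ℝ => Complex.ofReal (Del M a p.2.1)) * pd (0, 1, 0) u) =
    fun q => Complex.ofReal (Del M a q.2.1) * pd (0, 1, 0) u q := rfl
  have h2 : ((fun p : ℝ × ℝ × ℝ => Complex.ofReal (Real.sin p.2.2)) * pd (0, 0, 1) u) =
    fun q => Complex.ofReal (Real.sin q.2.2) * pd (0, 0, 1) u q := rfl
  rw [h1, h2]
  generalize pd (1, 0, 0) (pd (1, 0, 0) u) p = utt
  generalize pd (1, 0, 0) u p = ut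
  generalize pd (0, 1, 0) _ p = ur
  generalize pd (0, 0, 1) _ p = uθ
  rw [hSig]
  have hM3 : M = (p.2.1 ^ 2 + a ^ 2 - Del M a p.2.1) / (2 * p.2.1) := by
    rw [← hM2]; field_simp
  generalize Del M a p.2.1 = D at *
  generalize Real.sin p.2.2 = s at *
  generalize p.2.1 = r at *
  have hD' : (D : ℂ) ≠ 0 := by exact_mod_cast hΔ.ne'
  have hs' : (s : ℂ) ≠ 0 := by exact_mod_cast hs.ne'
  have hr' : (r : ℂ) ≠ 0 := by exact_mod_cast hr.ne'
  rw [hM3]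
  push_cast
  field_simp
  ring

variable {M a : ℝ} {m : ℤ}

lemma contDiffOn_ofReal {n : WithTop ℕ∞} {E : Type*} [NormedAddCommGroup E] [NormedSpace ℝ E]
    {U : Set E} {f : E → ℝ} (hf : ContDiffOn ℝ n f U) :
    ContDiffOn ℝ n (fun p => Complex.ofReal (f p)) U :=
  Complex.ofRealCLM.contDiff.comp_contDiffOn hf

lemma contDiffOn_Del {n : WithTop ℕ∞} {U : Set (ℝ × ℝ × ℝ)} :
    ContDiffOn ℝ n (fun p => Del M a p.2.1) U := by
  unfold Del
  fun_prop

lemma contDiffOn_sin {n : WithTop ℕ∞} {U : Set (ℝ × ℝ × ℝ)} :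
    ContDiffOn ℝ n (fun p => Real.sin p.2.2) U := by
  fun_prop

lemma contDiffOn_radial_coeffs (ha : 0 ≤ a) (haM : a ≤ M) :
    ContDiffOn ℝ 4 (fun p : ℝ × ℝ × ℝ =>
      Complex.ofReal ((p.2.1 ^ 2 + a ^ 2) ^ 2 / Del M a p.2.1)) (OmegaR M a) ∧
    ContDiffOn ℝ 4 (fun p : ℝ × ℝ × ℝ =>
      4 * Complex.I * (m : ℂ) * Complex.ofReal (M * a * p.2.1 / Del M a p.2.1)) (OmegaR M a) ∧
    ContDiffOn ℝ 4 (fun p : ℝ × ℝ × ℝ =>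
      -(m : ℂ) ^ 2 * Complex.ofReal (a ^ 2 / Del M a p.2.1)) (OmegaR M a) := by
  have hne : ∀ p ∈ OmegaR M a, Del M a p.2.1 ≠ 0 := fun p hp => (Del_pos ha haM hp.1).ne'
  refine ⟨contDiffOn_ofReal (ContDiffOn.div (by fun_prop) contDiffOn_Del hne),
    contDiffOn_const.mul (contDiffOn_ofReal (ContDiffOn.div (by fun_prop) contDiffOn_Del hne)),
    contDiffOn_const.mul (contDiffOn_ofReal (ContDiffOn.div (by fun_prop) contDiffOn_Del hne))⟩

lemma contDiffOn_angular_coeffs :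
    ContDiffOn ℝ 4 (fun p : ℝ × ℝ × ℝ =>
      Complex.ofReal (-(a ^ 2 * Real.sin p.2.2 ^ 2))) (OmegaR M a) ∧
    ContDiffOn ℝ 4 (fun p : ℝ × ℝ × ℝ =>
      Complex.ofReal (-(Real.sin p.2.2)⁻¹)) (OmegaR M a) ∧
    ContDiffOn ℝ 4 (fun p : ℝ × ℝ × ℝ =>
      (m : ℂ) ^ 2 * Complex.ofReal ((Real.sin p.2.2 ^ 2)⁻¹)) (OmegaR M a) := by
  have hne : ∀ p ∈ OmegaR M a, Real.sin p.2.2 ≠ 0 := fun p hp =>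
    (Real.sin_pos_of_pos_of_lt_pi hp.2.1 hp.2.2).ne'
  refine ⟨contDiffOn_ofReal (by fun_prop), contDiffOn_ofReal (contDiffOn_sin.inv hne).neg,
    contDiffOn_const.mul (contDiffOn_ofReal ((contDiffOn_sin.pow 2).inv
      fun p hp => pow_ne_zero 2 (hne p hp)))⟩

end Kerr

/-- `S` maps `C⁴` solutions of `□ₘ u = 0` to `C²` solutions. -/
theorem Sop_maps_solutions (M a : ℝ) (m : ℤ) (hM : 0 < M) (ha : 0 ≤ a) (haM : a ≤ M)
    (u : F3) (hu : ContDiffOn ℝ 4 u (OmegaR M a))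
    (hsol : ∀ p ∈ OmegaR M a, boxm M a m u p = 0) :
    (∀ p ∈ OmegaR M a, boxm M a m (Sop M a m u) p = 0) ∧
      ContDiffOn ℝ 2 (Sop M a m u) (OmegaR M a) := by
  have hU := isOpen_OmegaR M a
  obtain ⟨hα, hβ, hγ⟩ := contDiffOn_radial_coeffs (m := m) ha haM
  obtain ⟨hα', hη', hγ'⟩ := contDiffOn_angular_coeffs (M := M) (a := a) (m := m)
  have hδ : ContDiffOn ℝ 4 (fun p : ℝ × ℝ × ℝ => Complex.ofReal (Del M a p.2.1)) (OmegaR M a) :=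
    contDiffOn_ofReal contDiffOn_Del
  have hδ' : ContDiffOn ℝ 4 (fun p : ℝ × ℝ × ℝ => Complex.ofReal (Real.sin p.2.2))
    (OmegaR M a) := contDiffOn_ofReal contDiffOn_sin
  set A := radialOp M a m with hA
  set B := angularOp a m with hB
  set k : ℂ := -2 * Complex.I * (m : ℂ) * Complex.ofReal a with hk
  have hAB : Set.EqOn (A u + B u) 0 (OmegaR M a) := fun p hp => by
    have h := hsol p hp
    rw [boxm_eq] at h
    exact (mul_eq_zero.mp h).resolve_left
      (inv_ne_zero (by exact_mod_cast (Sig_pos_of_mem hM hp).ne'))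
  have hT : ContDiffOn ℝ 3 (pd (1, 0, 0) u) (OmegaR M a) := hu.pd hU (by norm_num) _
  have hT2 : ContDiffOn ℝ 2 (pd (1, 0, 0) u) (OmegaR M a) := hT.of_le (by norm_num)
  have hAu : ContDiffOn ℝ 2 (A u) (OmegaR M a) :=
    ContDiffOn.secondOrderOp hU (hα.of_le (by norm_num)) (hβ.of_le (by norm_num))
      contDiffOn_const (hδ.of_le (by norm_num)) (hγ.of_le (by norm_num)) hu (by norm_num)
  have hBu : ContDiffOn ℝ 2 (B u) (OmegaR M a) :=
    ContDiffOn.secondOrderOp hU (hα'.of_le (by norm_num)) contDiffOn_const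
      (hη'.of_le (by norm_num)) (hδ'.of_le (by norm_num)) (hγ'.of_le (by norm_num)) hu
      (by norm_num)
  have hS : Set.EqOn (Sop M a m u)
      ((fun _ => -1) * A u + (fun _ => k) * pd (1, 0, 0) u) (OmegaR M a) := fun p hp => by
    rw [Sop_eq hM ha haM m hp (hAB hp)]
    simp [hA, hk]
  have c1 : ContDiffOn ℝ 2 ((fun _ => -1) * A u) (OmegaR M a) := contDiffOn_const.mul hAu
  have c2 : ContDiffOn ℝ 2 ((fun _ => k) * pd (1, 0, 0) u) (OmegaR M a) :=
    contDiffOn_const.mul hT2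
  refine ⟨fun p hp => ?_, (c1.add c2).congr hS⟩
  have inv_const (c : ℂ) (e : ℝ × ℝ × ℝ) : InvariantAlong e (fun _ => c) := fun _ _ => rfl
  have hAmul (c : ℂ) (f : F3) : A ((fun _ => c) * f) = (fun _ => c) * A f :=
    secondOrderOp_mul (inv_const c _) (inv_const c _) f
  have hzero : A 0 = 0 := by
    have h := hAmul 0 0
    rwa [mul_zero, show (fun _ => (0 : ℂ)) * A 0 = 0 from zero_mul _] at h
  have hABcomm : Set.EqOn (A (B u)) (B (A u)) (OmegaR M a) := by
    refine secondOrderOp_comm hU hα hβ contDiffOn_const hδ hγ hα' contDiffOn_const hη' hδ' hγ'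
      hu ?_ ?_ <;>
    · rintro e (rfl | rfl) c (rfl | rfl | rfl | rfl | rfl) q t <;> simp
  have hAadd : Set.EqOn (A (A u + B u)) (A (A u) + A (B u)) (OmegaR M a) :=
    secondOrderOp_add hU (hδ.of_le (by norm_num)) hAu hBu
  have hkill : A (A u) p + B (A u) p = 0 := by
    rw [← hABcomm hp, ← Pi.add_apply, ← hAadd hp]
    exact (secondOrderOp_congr hU hAB hp).trans (congrFun hzero p)
  have hAT : A (pd (1, 0, 0) u) p = pd (1, 0, 0) (A u) p := by
    refine (pd_secondOrderOp hU (hα.of_le (by norm_num)) (hβ.of_le (by norm_num))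
      contDiffOn_const (hδ.of_le (by norm_num)) (hγ.of_le (by norm_num))
      (hu.of_le (by norm_num)) ?_ ?_ ?_ ?_ ?_ hp).symm <;>
    · intro q t
      simp
  have hBT : B (pd (1, 0, 0) u) p = pd (1, 0, 0) (B u) p := by
    refine (pd_secondOrderOp hU (hα'.of_le (by norm_num)) contDiffOn_const
      (hη'.of_le (by norm_num)) (hδ'.of_le (by norm_num)) (hγ'.of_le (by norm_num))
      (hu.of_le (by norm_num)) ?_ ?_ ?_ ?_ ?_ hp).symm <;>
    · intro q t
      simp
  have hkillT : A (pd (1, 0, 0) u) p + B (pd (1, 0, 0) u) p = 0 := by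
    rw [hAT, hBT, ← Pi.add_apply, ← pd_add hU (hAu.differentiableOn (by norm_num))
      (hBu.differentiableOn (by norm_num)) hp, pd_congr hU hAB hp]
    simp [pd, lineDeriv]
  have hBmul (c : ℂ) (f : F3) : B ((fun _ => c) * f) = (fun _ => c) * B f :=
    secondOrderOp_mul (inv_const c _) (inv_const c _) f
  have hAS : A (Sop M a m u) p = -A (A u) p + k * A (pd (1, 0, 0) u) p := by
    refine (secondOrderOp_congr hU hS hp).trans
      ((secondOrderOp_add hU (hδ.of_le (by norm_num)) c1 c2 hp).trans ?_)
    change A _ p + A _ p = _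
    simp [hAmul]
  have hBS : B (Sop M a m u) p = -B (A u) p + k * B (pd (1, 0, 0) u) p := by
    refine (secondOrderOp_congr hU hS hp).trans
      ((secondOrderOp_add hU (hδ'.of_le (by norm_num)) c1 c2 hp).trans ?_)
    change B _ p + B _ p = _
    simp [hBmul]
  rw [boxm_eq, ← hA, ← hB, hAS, hBS]
  linear_combination (Complex.ofReal (Sig a p.2.1 p.2.2))⁻¹ * (k * hkillT - hkill)
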